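/- (Theorem 2, sensing performance of sequential sensing with packet loss) Let D > 0, let K ≥ 1 be an integer, and let ε_1, …, ε_K ∈ [0,1]. On a probability space let ξ_1, …, ξ_K be identically distributed real random variables, each Gaussian with mean −D and variance 2D, and let B_1, …, B_K be {0,1}-valued random variables with P(B_k = 1) = 1 − ε_k for each k, such that the 2K random variables ξ_1, …, ξ_K, B_1, …, B_K are jointly independent. Then P( Σ_{k=1}^K B_k ξ_k > 0 ) ≤ ( e^{−D/4} + (1 − e^{−D/4}) · ε̄ )^K, where ε̄ = (1/K) Σ_{k=1}^K ε_k. -/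

import Mathlib

open MeasureTheory ProbabilityTheory

lemma seq_factor {Ω : Type*} [MeasurableSpace Ω] (P : Measure Ω) [IsProbabilityMeasure P]
    {K : ℕ} (ξ B : Fin K → Ω → ℝ)
    (hξmeas : ∀ k, Measurable (ξ k)) (hBmeas : ∀ k, Measurable (B k))
    (hindep : iIndepFun (Sum.elim ξ B) P) (s : Finset (Fin K)) :
    ∫⁻ ω, ∏ k ∈ s, ENNReal.ofReal (Real.exp (B k ω * ξ k ω / 2)) ∂P
      = ∏ k ∈ s, ∫⁻ ω, ENNReal.ofReal (Real.exp (B k ω * ξ k ω / 2)) ∂P := by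
  classical
  induction s using Finset.induction_on with
  | empty => simp
  | insert i s hi ih =>
    simp only [Finset.prod_insert hi]
    rw [← ih]
    have hm : ∀ j, Measurable (Sum.elim ξ B j) := by
      rintro (j | j)
      · exact hξmeas j
      · exact hBmeas j
    have hd : Disjoint (({i} : Finset (Fin K)).disjSum {i}) (s.disjSum s) := by
      rw [Finset.disjoint_left]
      rintro (j | j) h1 h2
      · simp at h1 h2
        subst h1
        exact hi h2
      · simp at h1 h2
        subst h1
        exact hi h2
    have h := hindep.indepFun_finset _ _ hd hm
    have hiS1 : Sum.inl i ∈ ({i} : Finset (Fin K)).disjSum {i} := by simp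
    have hiS2 : Sum.inr i ∈ ({i} : Finset (Fin K)).disjSum {i} := by simp
    let φ : ((({i} : Finset (Fin K)).disjSum {i} : Finset (Fin K ⊕ Fin K)) → ℝ) → ENNReal :=
      fun x => ENNReal.ofReal (Real.exp (x ⟨_, hiS2⟩ * x ⟨_, hiS1⟩ / 2))
    let ψ : (↥(s.disjSum s) → ℝ) → ENNReal :=
      fun x => ∏ k ∈ s.attach, ENNReal.ofReal (Real.exp
        (x ⟨Sum.inr k.1, Finset.inr_mem_disjSum.2 k.2⟩
          * x ⟨Sum.inl k.1, Finset.inl_mem_disjSum.2 k.2⟩ / 2))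
    have hφ : Measurable φ := by fun_prop
    have hψ : Measurable ψ := by fun_prop
    have h2 := h.comp hφ hψ
    have h3 : (fun ω => ∏ k ∈ s, ENNReal.ofReal (Real.exp (B k ω * ξ k ω / 2)))
        = ψ ∘ (fun ω (j : ↥(s.disjSum s)) => Sum.elim ξ B j ω) := by
      funext ω
      simp only [ψ, Function.comp, Sum.elim_inl, Sum.elim_inr]
      exact (Finset.prod_attach s
        (fun k => ENNReal.ofReal (Real.exp (B k ω * ξ k ω / 2)))).symm
    rw [← h3] at h2
    exact lintegral_mul_eq_lintegral_mul_lintegral_of_indepFun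
      (f := fun ω => ENNReal.ofReal (Real.exp (B i ω * ξ i ω / 2)))
      (by fun_prop) (by fun_prop) h2

lemma seq_single {Ω : Type*} [MeasurableSpace Ω] (P : Measure Ω) [IsProbabilityMeasure P]
    (D : ℝ) (hD : 0 < D) (e : ℝ) (he : e ∈ Set.Icc (0 : ℝ) 1) (ξ B : Ω → ℝ)
    (hξmeas : Measurable ξ) (hBmeas : Measurable B)
    (hξ : Measure.map ξ P = gaussianReal (-D) ((2 * D).toNNReal))
    (hB01 : ∀ ω, B ω = 0 ∨ B ω = 1)
    (hB : P {ω | B ω = 1} = ENNReal.ofReal (1 - e))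
    (hindep : IndepFun B ξ P) :
    ∫⁻ ω, ENNReal.ofReal (Real.exp (B ω * ξ ω / 2)) ∂P
      = ENNReal.ofReal (Real.exp (-D / 4) + (1 - Real.exp (-D / 4)) * e) := by
  have hS : MeasurableSet {ω | B ω = 1} := hBmeas (measurableSet_singleton 1)
  have h1 : ∀ ω, ENNReal.ofReal (Real.exp (B ω * ξ ω / 2))
      = {ω | B ω = 1}ᶜ.indicator 1 ω
        + ENNReal.ofReal (B ω) * ENNReal.ofReal (Real.exp (1 / 2 * ξ ω)) := by
    intro ω
    rcases hB01 ω with h | h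
    · simp [h]
    · simp [h]
      ring_nf
  have h2 : ∫⁻ ω, ENNReal.ofReal (B ω) ∂P = ENNReal.ofReal (1 - e) := by
    rw [← hB, ← lintegral_indicator_one hS]
    congr 1
    funext ω
    rcases hB01 ω with h | h <;> simp [h]
  have h3 : ∫⁻ ω, ENNReal.ofReal (Real.exp (1 / 2 * ξ ω)) ∂P
      = ENNReal.ofReal (Real.exp (-D / 4)) := by
    have hm := mgf_gaussianReal hξ (1 / 2)
    rw [← ofReal_integral_eq_lintegral_ofReal]
    · change ENNReal.ofReal (mgf ξ P (1 / 2)) = _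
      rw [hm, Real.coe_toNNReal _ (by positivity)]
      congr 2
      ring
    · have := integrable_exp_mul_gaussianReal (μ := -D) (v := (2 * D).toNNReal) (1 / 2)
      rw [← hξ] at this
      exact this.comp_measurable hξmeas
    · exact Filter.Eventually.of_forall fun ω => (Real.exp_pos _).le
  have h4 : P {ω | B ω = 1}ᶜ = ENNReal.ofReal e := by
    rw [prob_compl_eq_one_sub hS, hB, ← ENNReal.ofReal_one,
      ← ENNReal.ofReal_sub _ (by linarith [he.2])]
    congr 1
    ring
  have h5 := lintegral_mul_eq_lintegral_mul_lintegral_of_indepFun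
    (μ := P) (f := fun ω => ENNReal.ofReal (B ω))
    (g := fun ω => ENNReal.ofReal (Real.exp (1 / 2 * ξ ω)))
    (by fun_prop) (by fun_prop)
    (hindep.comp (φ := ENNReal.ofReal) (ψ := fun x => ENNReal.ofReal (Real.exp (1 / 2 * x)))
      (by fun_prop) (by fun_prop))
  simp only [Pi.mul_apply] at h5
  simp_rw [h1]
  rw [lintegral_add_left (measurable_one.indicator hS.compl), lintegral_indicator_one hS.compl,
    h4, h5, h2, h3, ← ENNReal.ofReal_mul (by linarith [he.2]),
    ← ENNReal.ofReal_add he.1 (mul_nonneg (by linarith [he.2]) (Real.exp_pos _).le)]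
  congr 1
  ring

/-- **Theorem 2, sensing performance of sequential sensing with packet
loss.** Let `D > 0`, `K ≥ 1`, `ε_k ∈ [0,1]`. Let `ξ_1, …, ξ_K` be Gaussian with mean
`-D` and variance `2D`, and let `B_1, …, B_K` be `{0,1}`-valued with
`P(B_k = 1) = 1 - ε_k`, with all `2K` variables jointly independent. Then
`P(Σ_k B_k ξ_k > 0) ≤ (e^{-D/4} + (1 - e^{-D/4}) ε̄)^K`. -/
theorem sequential_sensing_error_bound
    {Ω : Type*} [MeasurableSpace Ω] (P : Measure Ω) [IsProbabilityMeasure P]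
    (D : ℝ) (hD : 0 < D) (K : ℕ) (hK : 1 ≤ K)
    (ε : Fin K → ℝ) (hε : ∀ k, ε k ∈ Set.Icc (0 : ℝ) 1)
    (ξ B : Fin K → Ω → ℝ)
    (hξmeas : ∀ k, Measurable (ξ k)) (hBmeas : ∀ k, Measurable (B k))
    (hξ : ∀ k, Measure.map (ξ k) P = gaussianReal (-D) ((2 * D).toNNReal))
    (hB01 : ∀ k ω, B k ω = 0 ∨ B k ω = 1)
    (hB : ∀ k, P {ω | B k ω = 1} = ENNReal.ofReal (1 - ε k))
    (hindep : iIndepFun (Sum.elim ξ B) P) :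
    P {ω | 0 < ∑ k, B k ω * ξ k ω}
      ≤ ENNReal.ofReal
          ((Real.exp (-D / 4)
            + (1 - Real.exp (-D / 4)) * ((∑ k, ε k) / K)) ^ K) := by
  have hc1 : Real.exp (-D / 4) ≤ 1 := Real.exp_le_one_iff.2 (by linarith)
  have hc0 := Real.exp_pos (-D / 4)
  have hz : ∀ k, 0 ≤ Real.exp (-D / 4) + (1 - Real.exp (-D / 4)) * ε k := fun k =>
    add_nonneg hc0.le (mul_nonneg (by linarith) (hε k).1)
  have hK0 : (0 : ℝ) < K := by exact_mod_cast hK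
  have h1 : P {ω | 0 < ∑ k, B k ω * ξ k ω}
      ≤ ∫⁻ ω, ∏ k, ENNReal.ofReal (Real.exp (B k ω * ξ k ω / 2)) ∂P := by
    have hS : MeasurableSet {ω | 0 < ∑ k, B k ω * ξ k ω} :=
      measurableSet_lt measurable_const (by fun_prop)
    rw [← lintegral_indicator_one hS]
    apply lintegral_mono
    intro ω
    by_cases hω : ω ∈ {ω | 0 < ∑ k, B k ω * ξ k ω}
    swap
    · rw [Set.indicator_of_notMem hω]
      exact zero_le
    rw [Set.indicator_of_mem hω]
    beta_reduce
    rw [← ENNReal.ofReal_prod_of_nonneg (fun k _ => (Real.exp_pos _).le), ← Real.exp_sum,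
      ← Finset.sum_div]
    simp only [Pi.one_apply, ENNReal.one_le_ofReal, Real.one_le_exp_iff]
    have : 0 < ∑ k, B k ω * ξ k ω := hω
    positivity
  refine h1.trans ?_
  rw [seq_factor P ξ B hξmeas hBmeas hindep]
  rw [Finset.prod_congr rfl fun k _ => seq_single P D hD (ε k) (hε k) (ξ k) (B k) (hξmeas k)
    (hBmeas k) (hξ k) (hB01 k) (hB k)
    (hindep.indepFun (i := Sum.inr k) (j := Sum.inl k) (by simp))]
  rw [← ENNReal.ofReal_prod_of_nonneg (fun k _ => hz k)]
  apply ENNReal.ofReal_le_ofReal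
  have ham := Real.geom_mean_le_arith_mean_weighted (Finset.univ : Finset (Fin K))
    (fun _ => (K : ℝ)⁻¹) (fun k => Real.exp (-D / 4) + (1 - Real.exp (-D / 4)) * ε k)
    (fun _ _ => by positivity) (by simp [hK0.ne']) (fun k _ => hz k)
  have hr : ∑ k : Fin K, (K : ℝ)⁻¹ * (Real.exp (-D / 4) + (1 - Real.exp (-D / 4)) * ε k)
      = Real.exp (-D / 4) + (1 - Real.exp (-D / 4)) * ((∑ k, ε k) / K) := by
    rw [← Finset.mul_sum, Finset.sum_add_distrib, ← Finset.mul_sum]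
    simp
    field_simp
  rw [hr] at ham
  have hp := pow_le_pow_left₀
    (Finset.prod_nonneg fun k _ => Real.rpow_nonneg (hz k) _) ham K
  rw [← Finset.prod_pow] at hp
  simpa [Real.rpow_inv_natCast_pow (hz _) (by omega : K ≠ 0)] using hp
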